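/- arXiv:1709.06044 — 2 statements merged into one kernel-verified Lean document; each statement's English description precedes it below -/
import Mathlib

section
/- A Steiner triple system on 2^n - 1 points has 2-rank equal to 2^n - 1 - n if and only if it is isomorphic to the design PG_1(n-1,2) of points and lines of the projective geometry PG(n-1,2). -/
/-- A Steiner triple system given by its block family: every block has 3 points
and every pair of distinct points lies in exactly one block. -/
def isSTS {α : Type*} (B : Finset (Finset α)) : Prop :=
  (∀ b ∈ B, b.card = 3) ∧ ∀ x y : α, x ≠ y → ∃! b, b ∈ B ∧ x ∈ b ∧ y ∈ b

/-- The GF(p)-code spanned by the rows of the block-point incidence matrix. -/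
noncomputable def stsCode (p : ℕ) {α : Type*} [DecidableEq α] (B : Finset (Finset α)) :
    Submodule (ZMod p) (α → ZMod p) :=
  Submodule.span (ZMod p)
    ((fun b : Finset α => (fun x : α => if x ∈ b then (1 : ZMod p) else 0)) '' ↑B)

/-- The dual code of the block code: functions whose sum over every block vanishes. -/
def parityChecks (p : ℕ) {α : Type*} (B : Finset (Finset α)) :
    Submodule (ZMod p) (α → ZMod p) where
  carrier := {f | ∀ b ∈ B, ∑ x ∈ b, f x = 0}
  zero_mem' := by simp
  add_mem' := by
    intro f g hf hg b hb
    simp [Finset.sum_add_distrib, hf b hb, hg b hb]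
  smul_mem' := by
    intro c f hf b hb
    simp [← Finset.mul_sum, hf b hb]

theorem mem_parityChecks {p : ℕ} {α : Type*} {B : Finset (Finset α)} {f : α → ZMod p} :
    f ∈ parityChecks p B ↔ ∀ b ∈ B, ∑ x ∈ b, f x = 0 := Iff.rfl

theorem finrank_stsCode_add_finrank_parityChecks (p : ℕ) [Fact p.Prime] {α : Type*} [Fintype α]
    [DecidableEq α] (B : Finset (Finset α)) :
    Module.finrank (ZMod p) (stsCode p B) + Module.finrank (ZMod p) (parityChecks p B)
      = Fintype.card α := by
  let M : Matrix B α (ZMod p) := Matrix.of fun b x => if x ∈ b.1 then 1 else 0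
  have hcode : stsCode p B = Submodule.span (ZMod p) (Set.range M.row) := by
    unfold stsCode
    rw [Set.image_eq_range]
    rfl
  have hdual : parityChecks p B = LinearMap.ker M.mulVecLin := by
    ext f
    simp [mem_parityChecks, M, funext_iff, Matrix.mulVec, dotProduct]
  rw [hcode, hdual, ← Matrix.rank_eq_finrank_span_row, Matrix.rank,
    LinearMap.finrank_range_add_finrank_ker, Module.finrank_fintype_fun_eq_card]

theorem Finset.exists_eq_insert_pair_of_card_eq_three {α : Type*} [DecidableEq α] {b : Finset α}
    (hb : b.card = 3) {x y : α} (hx : x ∈ b) (hy : y ∈ b) (hxy : x ≠ y) :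
    ∃ z, x ≠ z ∧ y ≠ z ∧ b = {x, y, z} := by
  obtain ⟨u, v, w, huv, huw, hvw, rfl⟩ := Finset.card_eq_three.1 hb
  simp only [Finset.mem_insert, Finset.mem_singleton] at hx hy
  rcases hx with rfl | rfl | rfl <;> rcases hy with rfl | rfl | rfl <;>
    first
    | exact absurd rfl hxy
    | exact ⟨u, by tauto, by tauto, by grind⟩
    | exact ⟨v, by tauto, by tauto, by grind⟩
    | exact ⟨w, by tauto, by tauto, by grind⟩

theorem isSTS.exists_insert_pair_mem {α : Type*} [DecidableEq α] {B : Finset (Finset α)}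
    (hB : isSTS B) {x y : α} (hxy : x ≠ y) :
    ∃ z, x ≠ z ∧ y ≠ z ∧ ({x, y, z} : Finset α) ∈ B := by
  obtain ⟨b, ⟨hb, hx, hy⟩, -⟩ := hB.2 x y hxy
  obtain ⟨z, hxz, hyz, rfl⟩ :=
    Finset.exists_eq_insert_pair_of_card_eq_three (hB.1 b hb) hx hy hxy
  exact ⟨z, hxz, hyz, hb⟩

theorem ZModModule.eq_add_of_add_add_eq_zero {V : Type*} [AddCommGroup V] [Module (ZMod 2) V]
    {x y z : V} (h : x + (y + z) = 0) : z = x + y := by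
  rw [← add_assoc] at h
  rw [eq_comm, ← sub_eq_zero, ZModModule.sub_eq_add, h]

/-- A labelling of a Steiner triple system by vectors over GF(2), with zero sum on each block,
takes on every nonzero vector of its span. -/
theorem isSTS.exists_eq_of_mem_span {α V : Type*} [DecidableEq α] [AddCommGroup V]
    [Module (ZMod 2) V] {B : Finset (Finset α)} (hB : isSTS B) {φ : α → V}
    (hφ : ∀ b ∈ B, ∑ x ∈ b, φ x = 0) {v : V}
    (hv : v ∈ Submodule.span (ZMod 2) (Set.range φ)) : v = 0 ∨ ∃ a, φ a = v := by
  induction hv using Submodule.span_induction with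
  | mem v hv => exact Or.inr hv
  | zero => exact Or.inl rfl
  | add v w _ _ hv hw =>
    rcases hv with rfl | ⟨x, rfl⟩
    · simpa using hw
    rcases hw with rfl | ⟨y, rfl⟩
    · exact Or.inr ⟨x, by simp⟩
    by_cases hxy : x = y
    · subst hxy
      exact Or.inl (ZModModule.add_self _)
    obtain ⟨z, hxz, hyz, hb⟩ := hB.exists_insert_pair_mem hxy
    have h := hφ _ hb
    rw [Finset.sum_insert (by simp [hxy, hxz]), Finset.sum_pair hyz] at h
    exact Or.inr ⟨z, ZModModule.eq_add_of_add_add_eq_zero h⟩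
  | smul c v _ hv =>
    obtain rfl | rfl : c = 0 ∨ c = 1 := by revert c; decide
    · simp
    · simpa using hv

theorem isSTS.exists_equiv_of_span_eq_top {α V : Type*} [Fintype α] [DecidableEq α]
    [AddCommGroup V] [Module (ZMod 2) V] [Finite V] {B : Finset (Finset α)} (hB : isSTS B)
    {φ : α → V} (hφ : ∀ b ∈ B, ∑ x ∈ b, φ x = 0)
    (hspan : Submodule.span (ZMod 2) (Set.range φ) = ⊤)
    (hcard : Fintype.card α + 1 = Nat.card V) :
    ∃ e : α ≃ {v : V // v ≠ 0}, ∀ a, (e a : V) = φ a := by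
  have := Fintype.ofFinite V
  let ψ : Option α → V := fun o => o.elim 0 φ
  have hsurj : Function.Surjective ψ := by
    intro v
    obtain rfl | ⟨a, rfl⟩ := hB.exists_eq_of_mem_span hφ (hspan ▸ Submodule.mem_top : v ∈ _)
    exacts [⟨none, rfl⟩, ⟨some a, rfl⟩]
  have hinj : Function.Injective ψ :=
    ((Fintype.bijective_iff_surjective_and_card ψ).2
      ⟨hsurj, by rw [Fintype.card_option, hcard, Nat.card_eq_fintype_card]⟩).1
  have hne : ∀ a, φ a ≠ 0 := fun a h => by
    simpa using hinj (show ψ (some a) = ψ none from h)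
  refine ⟨Equiv.ofBijective (fun a => ⟨φ a, hne a⟩) ⟨fun a a' h => ?_, ?_⟩, fun a => rfl⟩
  · exact Option.some_injective _ (hinj (show ψ (some a) = ψ (some a') from congrArg Subtype.val h))
  · rintro ⟨v, hv⟩
    obtain ⟨_ | a, rfl⟩ := hsurj v
    · exact absurd rfl hv
    · exact ⟨a, rfl⟩

theorem span_range_parityChecks_eval_eq_top {p : ℕ} [Fact p.Prime] {α : Type*} [Fintype α]
    (B : Finset (Finset α)) :
    Submodule.span (ZMod p) (Set.range fun a : α =>
      (LinearMap.proj a : (α → ZMod p) →ₗ[ZMod p] ZMod p) ∘ₗ (parityChecks p B).subtype) = ⊤ := by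
  by_contra h
  obtain ⟨f, hf, hle⟩ := Submodule.exists_le_ker_of_lt_top _ (lt_top_iff_ne_top.2 h)
  obtain ⟨d, rfl⟩ := (Module.evalEquiv (ZMod p) (parityChecks p B)).surjective f
  apply hf
  suffices d = 0 by simp [this]
  ext a
  simpa using hle (Submodule.subset_span ⟨a, rfl⟩)

/-- A labelling by the nonzero vectors over GF(2) with zero sum on each block identifies the
blocks with the lines. -/
theorem isSTS.mem_iff_image_eq_line {α V : Type*} [DecidableEq α] [AddCommGroup V]
    [Module (ZMod 2) V] [DecidableEq V] {B : Finset (Finset α)} (hB : isSTS B)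
    (e : α ≃ {v : V // v ≠ 0}) (he : ∀ b ∈ B, ∑ x ∈ b, (e x : V) = 0) (b : Finset α) :
    b ∈ B ↔ ∃ x y : V, x ≠ 0 ∧ y ≠ 0 ∧ x ≠ y ∧
      b.image (fun a => (e a : V)) = {x, y, x + y} := by
  have hinj : Function.Injective fun a => (e a : V) := Subtype.val_injective.comp e.injective
  have hline : ∀ {x y z : α}, x ≠ y → x ≠ z → y ≠ z → ({x, y, z} : Finset α) ∈ B →
      (e z : V) = e x + e y := by
    intro x y z hxy hxz hyz hb
    have h := he _ hb
    rw [Finset.sum_insert (by simp [hxy, hxz]), Finset.sum_pair hyz] at h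
    exact ZModModule.eq_add_of_add_add_eq_zero h
  constructor
  · intro hb
    obtain ⟨x, y, z, hxy, hxz, hyz, rfl⟩ := Finset.card_eq_three.1 (hB.1 b hb)
    refine ⟨e x, e y, (e x).2, (e y).2, hinj.ne hxy, ?_⟩
    rw [← hline hxy hxz hyz hb]
    simp [Finset.image_insert]
  · rintro ⟨v, w, hv, hw, hvw, h⟩
    obtain ⟨x, hx⟩ := e.surjective ⟨v, hv⟩
    obtain ⟨y, hy⟩ := e.surjective ⟨w, hw⟩
    have hxy : x ≠ y := by
      rintro rfl
      exact hvw (congrArg Subtype.val (hx.symm.trans hy))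
    obtain ⟨z, hxz, hyz, hb⟩ := hB.exists_insert_pair_mem hxy
    have hz := hline hxy hxz hyz hb
    have hbxyz : b = {x, y, z} := by
      apply Finset.image_injective hinj
      rw [h]
      simp [Finset.image_insert, hz, hx, hy]
    rwa [hbxyz]

/-- If the blocks are the lines of the binary projective space on `V`, the dual code consists of
the restrictions of the linear functionals on `V`. -/
theorem finrank_parityChecks_of_lines {α V : Type*} [DecidableEq α] [AddCommGroup V]
    [Module (ZMod 2) V] [FiniteDimensional (ZMod 2) V] [DecidableEq V] {B : Finset (Finset α)}
    (e : α ≃ {v : V // v ≠ 0})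
    (he : ∀ b : Finset α, b ∈ B ↔ ∃ x y : V, x ≠ 0 ∧ y ≠ 0 ∧ x ≠ y ∧
      b.image (fun a => (e a : V)) = {x, y, x + y}) :
    Module.finrank (ZMod 2) (parityChecks 2 B) = Module.finrank (ZMod 2) V := by
  have hinj : Function.Injective fun a => (e a : V) := Subtype.val_injective.comp e.injective
  have hadd_ne : ∀ {x y : V}, x ≠ y → x + y ≠ 0 := fun hxy h =>
    hxy (by rwa [← ZModModule.sub_eq_add, sub_eq_zero] at h)
  let T : Module.Dual (ZMod 2) V →ₗ[ZMod 2] (α → ZMod 2) :=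
    { toFun := fun f a => f (e a)
      map_add' := fun f g => rfl
      map_smul' := fun c f => rfl }
  have hT : Function.Injective T := by
    intro f g h
    ext v
    by_cases hv : v = 0
    · simp [hv]
    · simpa [T] using congrFun h (e.symm ⟨v, hv⟩)
  have hrange : LinearMap.range T = parityChecks 2 B := by
    apply le_antisymm
    · rintro _ ⟨f, rfl⟩ b hb
      obtain ⟨x, y, hx, hy, hxy, h⟩ := (he b).1 hb
      calc ∑ a ∈ b, f (e a) = ∑ v ∈ b.image (fun a => (e a : V)), f v :=
            (Finset.sum_image (f := fun v => f v) hinj.injOn).symm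
        _ = f x + (f y + f (x + y)) := by
            rw [h, Finset.sum_insert (by simp [hxy, hy]), Finset.sum_pair (by simp [hx])]
        _ = 0 := by
            rw [map_add, ← add_assoc, ZModModule.add_self]
    · intro g hg
      let F : V → ZMod 2 := fun v => if hv : v = 0 then 0 else g (e.symm ⟨v, hv⟩)
      have hF0 : F 0 = 0 := by simp [F]
      have hFne : ∀ a, F (e a) = g a := fun a => by simp [F, (e a).2]
      have hFadd : ∀ x y, F (x + y) = F x + F y := by
        intro x y
        by_cases hx : x = 0
        · simp [hx, hF0]
        by_cases hy : y = 0
        · simp [hy, hF0]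
        by_cases hxy : x = y
        · rw [hxy, ZModModule.add_self, ZModModule.add_self, hF0]
        obtain ⟨p, hp⟩ := e.surjective ⟨x, hx⟩
        obtain ⟨q, hq⟩ := e.surjective ⟨y, hy⟩
        obtain ⟨r, hr⟩ := e.surjective ⟨x + y, hadd_ne hxy⟩
        have hp' : (e p : V) = x := by rw [hp]
        have hq' : (e q : V) = y := by rw [hq]
        have hr' : (e r : V) = x + y := by rw [hr]
        have hpq : p ≠ q := by rintro rfl; exact hxy (hp'.symm.trans hq')
        have hpr : p ≠ r := by rintro rfl; exact hy (by simpa using hp'.symm.trans hr')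
        have hqr : q ≠ r := by rintro rfl; exact hx (by simpa using hq'.symm.trans hr')
        have h := hg {p, q, r}
          ((he _).2 ⟨x, y, hx, hy, hxy, by simp [Finset.image_insert, hp', hq', hr']⟩)
        rw [Finset.sum_insert (by simp [hpq, hpr]), Finset.sum_pair hqr] at h
        rw [← hr', ← hp', ← hq', hFne, hFne, hFne]
        exact ZModModule.eq_add_of_add_add_eq_zero h
      exact ⟨(AddMonoidHom.mk' F hFadd).toZModLinearMap 2, funext hFne⟩
  rw [← hrange, LinearMap.finrank_range_of_inj hT, Subspace.dual_finrank_eq]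

theorem stmt3 {α : Type*} [Fintype α] [DecidableEq α] (B : Finset (Finset α))
    (hSTS : isSTS B) (n : ℕ) (hv : Fintype.card α = 2 ^ n - 1) :
    Module.finrank (ZMod 2) (stsCode 2 B) = 2 ^ n - 1 - n ↔
      ∃ e : α ≃ {v : Fin n → ZMod 2 // v ≠ 0},
        ∀ b : Finset α, b ∈ B ↔
          ∃ x y : Fin n → ZMod 2, x ≠ 0 ∧ y ≠ 0 ∧ x ≠ y ∧
            b.image (fun a => ((e a : {v : Fin n → ZMod 2 // v ≠ 0}) : Fin n → ZMod 2))
              = {x, y, x + y} := by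
  have hrank := finrank_stsCode_add_finrank_parityChecks 2 B
  have hn : n < 2 ^ n := Nat.lt_two_pow_self
  constructor
  · intro h
    have hdim : Module.finrank (ZMod 2) (parityChecks 2 B) = n := by omega
    let L : Module.Dual (ZMod 2) (parityChecks 2 B) ≃ₗ[ZMod 2] (Fin n → ZMod 2) :=
      LinearEquiv.ofFinrankEq _ _ (by rw [Subspace.dual_finrank_eq, hdim, Module.finrank_fin_fun])
    let φ : α → Module.Dual (ZMod 2) (parityChecks 2 B) := fun a =>
      (LinearMap.proj a : (α → ZMod 2) →ₗ[ZMod 2] ZMod 2) ∘ₗ (parityChecks 2 B).subtype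
    have hφ : ∀ b ∈ B, ∑ x ∈ b, φ x = 0 := by
      intro b hb
      ext d
      simpa [φ] using d.2 b hb
    have hLφ : ∀ b ∈ B, ∑ x ∈ b, L (φ x) = 0 := fun b hb => by
      rw [← map_sum, hφ b hb, map_zero]
    have hspan : Submodule.span (ZMod 2) (Set.range fun a => L (φ a)) = ⊤ := by
      rw [show (Set.range fun a => L (φ a)) = L.toLinearMap '' Set.range φ from
          Set.range_comp L φ, ← Submodule.map_span, span_range_parityChecks_eval_eq_top B]
      simp
    obtain ⟨e, he⟩ := hSTS.exists_equiv_of_span_eq_top hLφ hspan (by simp; omega)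
    refine ⟨e, hSTS.mem_iff_image_eq_line e fun b hb => ?_⟩
    simpa only [he] using hLφ b hb
  · rintro ⟨e, he⟩
    have hdim := finrank_parityChecks_of_lines e he
    rw [Module.finrank_fin_fun] at hdim
    omega
end

section
/- The number of distinct Steiner triple systems on 2^n - 1 points whose blocks are supports of weight-3 codewords of the binary code with parity check matrix H_{n,t} equals N_1(T) · (N_2(T+1) · T!)^M · N_3(T+1)^{M(M-1)/6}, where T = 2^t - 1 and M = 2^{n-t} - 1. -/
/-- `N₁ v`: the number of distinct (labeled) Steiner triple systems on a fixed `v`-set. -/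
noncomputable def N1 (v : ℕ) : ℕ := Nat.card {B : Finset (Finset (Fin v)) // isSTS B}

/-- A 1-factor (perfect matching) of the complete graph on `V`. -/
def isOneFactor {V : Type*} (f : Finset (Finset V)) : Prop :=
  (∀ e ∈ f, e.card = 2) ∧ ∀ x : V, ∃! e, e ∈ f ∧ x ∈ e

/-- A 1-factorization of the complete graph on `V`. -/
def isOneFactorization {V : Type*} (F : Finset (Finset (Finset V))) : Prop :=
  (∀ f ∈ F, isOneFactor f) ∧ ∀ e : Finset V, e.card = 2 → ∃! f, f ∈ F ∧ e ∈ f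

/-- `N₂ m`: the number of distinct 1-factorizations of the complete graph `K_m`. -/
noncomputable def N2 (m : ℕ) : ℕ :=
  Nat.card {F : Finset (Finset (Finset (Fin m))) // isOneFactorization F}

/-- A Latin square of order `g` (equivalently, a transversal design `TD[3;g]`). -/
def isLatin {g : ℕ} (L : Fin g → Fin g → Fin g) : Prop :=
  (∀ i, Function.Bijective (L i)) ∧ (∀ j, Function.Bijective fun i => L i j)

/-- `N₃ g`: the number of Latin squares of order `g`. -/
noncomputable def N3 (g : ℕ) : ℕ := Nat.card {L : Fin g → Fin g → Fin g // isLatin L}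

abbrev binIdx (n t : ℕ) :=
  Fin (2 ^ t - 1) ⊕ ({p : Fin (n - t) → ZMod 2 // p ≠ 0} × Fin (2 ^ t))

def binCol {n t : ℕ} : binIdx n t → (Fin (n - t) → ZMod 2) :=
  Sum.elim (fun _ => 0) (fun q => q.1.1)

section ColoredSystems

variable {α V : Type*} [AddCommGroup V]

lemma eq_add_of_add_eq_zero (hV : ∀ v : V, v + v = 0) {u v w : V} (h : u + v + w = 0) :
    w = u + v := by
  rw [← sub_eq_zero, sub_eq_add_neg, neg_eq_of_add_eq_zero_left (hV _), add_comm, h]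

variable [DecidableEq α]

lemma exists_third_point (hV : ∀ v : V, v + v = 0) {c : α → V} {b : Finset α} (hb : b.card = 3)
    (hs : ∑ j ∈ b, c j = 0) {x y : α} (hxy : x ≠ y) (hx : x ∈ b) (hy : y ∈ b) :
    ∃ z, z ≠ x ∧ z ≠ y ∧ b = {x, y, z} ∧ c z = c x + c y := by
  have h1 : ((b.erase x).erase y).card = 1 := by
    rw [Finset.card_erase_of_mem (by simp [hy, hxy.symm]), Finset.card_erase_of_mem hx, hb]
  obtain ⟨z, hz⟩ := Finset.card_eq_one.1 h1
  have hzm : z ∈ (b.erase x).erase y := by simp [hz]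
  simp only [Finset.mem_erase] at hzm
  have hbe : b = {x, y, z} := by
    rw [← Finset.insert_erase hx, ← Finset.insert_erase (s := b.erase x) (a := y)
      (by simp [hy, hxy.symm]), hz]
  refine ⟨z, hzm.2.1, hzm.1, hbe, ?_⟩
  subst hbe
  rw [Finset.sum_insert (by simp [hxy, hzm.2.1.symm]), Finset.sum_insert (by simp [hzm.1.symm]),
    Finset.sum_singleton, ← add_assoc] at hs
  exact eq_add_of_add_eq_zero hV hs

variable [DecidableEq V]

/-- `B` consists of zero-sum triples whose set of colors is `i`, and covers exactly once every pair
of points that can only be completed to a zero-sum triple by using the set of colors `i`. -/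
def IsPartialSystem (c : α → V) (i : Finset V) (B : Finset (Finset α)) : Prop :=
  (∀ b ∈ B, (b.card = 3 ∧ ∑ j ∈ b, c j = 0) ∧ b.image c = i) ∧
    ∀ x y, x ≠ y → ({c x, c y, c x + c y} : Finset V) = i → ∃! b, b ∈ B ∧ x ∈ b ∧ y ∈ b

lemma image_eq_of_mem (hV : ∀ v : V, v + v = 0) {c : α → V} {b : Finset α} (hb : b.card = 3)
    (hs : ∑ j ∈ b, c j = 0) {x y : α} (hxy : x ≠ y) (hx : x ∈ b) (hy : y ∈ b) :
    b.image c = {c x, c y, c x + c y} := by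
  obtain ⟨z, -, -, rfl, hz⟩ := exists_third_point hV hb hs hxy hx hy
  simp [hz]

/-- A Steiner triple system of zero-sum triples splits into its parts with a given set of colors. -/
noncomputable def systemEquivPi [Fintype α] (hV : ∀ v : V, v + v = 0) (c : α → V) :
    {B : Finset (Finset α) // isSTS B ∧ ∀ b ∈ B, ∑ j ∈ b, c j = 0} ≃
      ∀ i : Finset V, {B : Finset (Finset α) // IsPartialSystem c i B} where
  toFun B i := ⟨B.1.filter fun b => b.image c = i, by
    obtain ⟨B, ⟨h3, hu⟩, hs⟩ := B
    refine ⟨fun b hb => ?_, fun x y hxy hi => ?_⟩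
    · rw [Finset.mem_filter] at hb
      exact ⟨⟨h3 b hb.1, hs b hb.1⟩, hb.2⟩
    · obtain ⟨b, ⟨hb, hx, hy⟩, huniq⟩ := hu x y hxy
      refine ⟨b, ⟨?_, hx, hy⟩, fun b' hb' => ?_⟩
      · rw [Finset.mem_filter]
        exact ⟨hb, by rw [image_eq_of_mem hV (h3 b hb) (hs b hb) hxy hx hy, hi]⟩
      · exact huniq b' ⟨(Finset.mem_filter.1 hb'.1).1, hb'.2⟩⟩
  invFun f := ⟨Finset.univ.filter fun b => b ∈ (f (b.image c)).1, by
    refine ⟨⟨fun b hb => ?_, fun x y hxy => ?_⟩, fun b hb => ?_⟩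
    · exact ((f _).2.1 b (by simpa using hb)).1.1
    · obtain ⟨b, ⟨hb, hx, hy⟩, huniq⟩ := (f {c x, c y, c x + c y}).2.2 x y hxy rfl
      refine ⟨b, ⟨?_, hx, hy⟩, fun b' hb' => ?_⟩
      · rw [Finset.mem_filter, ((f _).2.1 b hb).2]
        exact ⟨Finset.mem_univ b, hb⟩
      · have hm : b' ∈ (f (b'.image c)).1 := by simpa using hb'.1
        have h := (f _).2.1 b' hm
        rw [image_eq_of_mem hV h.1.1 h.1.2 hxy hb'.2.1 hb'.2.2] at hm
        exact huniq b' ⟨hm, hb'.2⟩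
    · exact ((f _).2.1 b (by simpa using hb)).1.2⟩
  left_inv B := by
    ext b
    simp
  right_inv f := by
    funext i
    ext b
    simp only [Finset.mem_filter, Finset.mem_univ, true_and]
    refine ⟨fun h => h.2 ▸ h.1, fun h => ?_⟩
    have h' := ((f i).2.1 b h).2
    exact ⟨h'.symm ▸ h, h'⟩

/-- Transport of a partial system along a parametrization of the admissible triples. -/
noncomputable def partialSystemEquiv {K : Type*} [Fintype K] [DecidableEq K] {c : α → V}
    {i : Finset V} (D : K → Prop) (φ : K → Finset α) (hinj : Function.Injective φ)
    (hD : ∀ k, D k ↔ ((φ k).card = 3 ∧ ∑ j ∈ φ k, c j = 0) ∧ (φ k).image c = i)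
    (hsurj : ∀ b : Finset α, b.card = 3 → ∑ j ∈ b, c j = 0 → b.image c = i → ∃ k, φ k = b) :
    {B : Finset (Finset α) // IsPartialSystem c i B} ≃
      {S : Finset K // (∀ k ∈ S, D k) ∧ ∀ x y, x ≠ y →
        ({c x, c y, c x + c y} : Finset V) = i → ∃! k, k ∈ S ∧ x ∈ φ k ∧ y ∈ φ k} where
  toFun B := ⟨Finset.univ.filter fun k => φ k ∈ B.1, by
    obtain ⟨B, hB, hu⟩ := B
    refine ⟨fun k hk => (hD k).2 (hB _ (by simpa using hk)), fun x y hxy hi => ?_⟩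
    obtain ⟨b, ⟨hb, hx, hy⟩, huniq⟩ := hu x y hxy hi
    obtain ⟨k, rfl⟩ := hsurj b (hB b hb).1.1 (hB b hb).1.2 (hB b hb).2
    exact ⟨k, ⟨by simpa using hb, hx, hy⟩,
      fun k' hk' => hinj (huniq _ ⟨by simpa using hk'.1, hk'.2⟩)⟩⟩
  invFun S := ⟨S.1.image φ, by
    obtain ⟨S, hS, hu⟩ := S
    refine ⟨fun b hb => ?_, fun x y hxy hi => ?_⟩
    · obtain ⟨k, hk, rfl⟩ := Finset.mem_image.1 hb
      exact (hD k).1 (hS k hk)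
    · obtain ⟨k, ⟨hk, hx, hy⟩, huniq⟩ := hu x y hxy hi
      refine ⟨φ k, ⟨Finset.mem_image_of_mem φ hk, hx, hy⟩, ?_⟩
      rintro b ⟨hb, hx', hy'⟩
      obtain ⟨k', hk', rfl⟩ := Finset.mem_image.1 hb
      rw [huniq k' ⟨hk', hx', hy'⟩]⟩
  left_inv B := by
    ext b
    simp only [Finset.mem_image, Finset.mem_filter, Finset.mem_univ, true_and]
    constructor
    · rintro ⟨k, hk, rfl⟩
      exact hk
    · intro hb
      have h := B.2.1 b hb
      obtain ⟨k, rfl⟩ := hsurj b h.1.1 h.1.2 h.2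
      exact ⟨k, hb, rfl⟩
  right_inv S := by
    ext k
    simp [hinj.eq_iff]

end ColoredSystems

lemma existsUnique_mem_and_and_swap {K : Type*} {S : Finset K} {P Q : K → Prop}
    (h : ∃! k, k ∈ S ∧ P k ∧ Q k) : ∃! k, k ∈ S ∧ Q k ∧ P k := by
  simpa only [and_comm (a := Q _)] using h

lemma existsUnique_mem_and_iff {K L : Type*} {S : Finset K} {P : K → Prop} (f : L → K)
    (hf : Function.Injective f) (hP : ∀ k, P k ↔ ∃ l, f l = k) :
    (∃! k, k ∈ S ∧ P k) ↔ ∃! l, f l ∈ S := by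
  constructor
  · rintro ⟨k, ⟨hk, hPk⟩, hu⟩
    obtain ⟨l, rfl⟩ := (hP k).1 hPk
    exact ⟨l, hk, fun l' hl' => hf (hu _ ⟨hl', (hP _).2 ⟨l', rfl⟩⟩)⟩
  · rintro ⟨l, hl, hu⟩
    refine ⟨f l, ⟨hl, (hP _).2 ⟨l, rfl⟩⟩, ?_⟩
    rintro k ⟨hk, hPk⟩
    obtain ⟨l', rfl⟩ := (hP k).1 hPk
    rw [hu l' hk]

/-- An ordered one-factorization: one-factors indexed by `Z` that partition the edges. -/
def IsIndexedFactorization {Z G : Type*} (f : Z → Finset (Finset G)) : Prop :=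
  (∀ z, isOneFactor (f z)) ∧ ∀ e : Finset G, e.card = 2 → ∃! z, e ∈ f z

lemma card_latin_eq_card_triples {g : ℕ} :
    N3 g = Nat.card {S : Finset (Fin g × Fin g × Fin g) // (∀ a b, ∃! d, (a, b, d) ∈ S) ∧
      (∀ a d, ∃! b, (a, b, d) ∈ S) ∧ ∀ b d, ∃! a, (a, b, d) ∈ S} := by
  let F (L : Fin g → Fin g → Fin g) : Finset (Fin g × Fin g × Fin g) :=
    Finset.univ.filter fun k => L k.1 k.2.1 = k.2.2
  have hF (L a b d) : (a, b, d) ∈ F L ↔ L a b = d := by simp [F]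
  refine Nat.card_eq_of_bijective (fun L => ⟨F L.1, ?_, ?_, ?_⟩) ⟨fun L L' h => ?_, fun S => ?_⟩
  · simp [hF]
  · simpa only [hF] using fun a => (L.2.1 a).existsUnique
  · simpa only [hF] using fun b => (L.2.2 b).existsUnique
  · refine Subtype.ext (funext₂ fun a b => ?_)
    have h' : F L.1 = F L'.1 := congrArg Subtype.val h
    exact ((hF L'.1 a b _).1 (h' ▸ (hF L.1 a b _).2 rfl)).symm
  · obtain ⟨S, h1, h2, h3⟩ := S
    have h1' := h1
    choose L hL hu using h1'
    have hS (a b d) : (a, b, d) ∈ S ↔ L a b = d :=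
      ⟨fun h => (hu a b d h).symm, fun h => h ▸ hL a b⟩
    simp only [hS] at h2 h3
    refine ⟨⟨L, fun a => (Function.bijective_iff_existsUnique _).2 (h2 a),
      fun b => (Function.bijective_iff_existsUnique _).2 (h3 b)⟩, Subtype.ext ?_⟩
    ext ⟨a, b, d⟩
    rw [hS, hF]

section Counting

variable {V Z G : Type*} [AddCommGroup V] [DecidableEq V] [DecidableEq Z]

/-- The points of `Z` have color zero, and every nonzero color is shared by a copy of `G`. -/
def pointColor : Z ⊕ ({p : V // p ≠ 0} × G) → V :=
  Sum.elim (fun _ => 0) (fun q => q.1.1)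

lemma card_partialSystem_line (hV : ∀ v : V, v + v = 0) {g : ℕ} {p q r : {p : V // p ≠ 0}}
    (hpq : p ≠ q) (hpr : p ≠ r) (hqr : q ≠ r) (h : p.1 + q.1 = r.1) :
    Nat.card {B : Finset (Finset (Z ⊕ ({p : V // p ≠ 0} × Fin g))) //
        IsPartialSystem pointColor {p.1, q.1, r.1} B} = N3 g := by
  have hqp : q.1 + p.1 = r.1 := by rw [add_comm, h]
  have hpr' : p.1 + r.1 = q.1 := by rw [← h, ← add_assoc, hV, zero_add]
  have hqr' : q.1 + r.1 = p.1 := by rw [← h, add_left_comm, hV, add_zero]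
  have hrp' : r.1 + p.1 = q.1 := by rw [add_comm, hpr']
  have hrq' : r.1 + q.1 = p.1 := by rw [add_comm, hqr']
  let φ (k : Fin g × Fin g × Fin g) : Finset (Z ⊕ ({p : V // p ≠ 0} × Fin g)) :=
    {Sum.inr (p, k.1), Sum.inr (q, k.2.1), Sum.inr (r, k.2.2)}
  have hφ1 (k a) : Sum.inr (p, a) ∈ φ k ↔ a = k.1 := by simp [φ, hpq, hpr]
  have hφ2 (k a) : Sum.inr (q, a) ∈ φ k ↔ a = k.2.1 := by simp [φ, hpq.symm, hqr]
  have hφ3 (k a) : Sum.inr (r, a) ∈ φ k ↔ a = k.2.2 := by simp [φ, hpr.symm, hqr.symm]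
  have h12 (S : Finset (Fin g × Fin g × Fin g)) (a b) :
      (∃! k, k ∈ S ∧ Sum.inr (p, a) ∈ φ k ∧ Sum.inr (q, b) ∈ φ k) ↔ ∃! d, (a, b, d) ∈ S :=
    existsUnique_mem_and_iff (fun d => (a, b, d)) (fun _ _ => by simp)
      fun ⟨_, _, _⟩ => by simp [hφ1, hφ2]
  have h13 (S : Finset (Fin g × Fin g × Fin g)) (a d) :
      (∃! k, k ∈ S ∧ Sum.inr (p, a) ∈ φ k ∧ Sum.inr (r, d) ∈ φ k) ↔ ∃! b, (a, b, d) ∈ S :=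
    existsUnique_mem_and_iff (fun b => (a, b, d)) (fun _ _ => by simp)
      fun ⟨_, _, _⟩ => by simp [hφ1, hφ3]
  have h23 (S : Finset (Fin g × Fin g × Fin g)) (b d) :
      (∃! k, k ∈ S ∧ Sum.inr (q, b) ∈ φ k ∧ Sum.inr (r, d) ∈ φ k) ↔ ∃! a, (a, b, d) ∈ S :=
    existsUnique_mem_and_iff (fun a => (a, b, d)) (fun _ _ => by simp)
      fun ⟨_, _, _⟩ => by simp [hφ2, hφ3]
  rw [card_latin_eq_card_triples]
  refine Nat.card_congr ((partialSystemEquiv (fun _ => True) φ ?_ ?_ ?_).trans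
    (Equiv.subtypeEquivRight fun S => ?_))
  · intro k k' hk
    have e1 := (hφ1 k' k.1).1 (hk ▸ (hφ1 k _).2 rfl)
    have e2 := (hφ2 k' k.2.1).1 (hk ▸ (hφ2 k _).2 rfl)
    have e3 := (hφ3 k' k.2.2).1 (hk ▸ (hφ3 k _).2 rfl)
    exact Prod.ext e1 (Prod.ext e2 e3)
  · intro k
    refine iff_of_true trivial ⟨⟨?_, ?_⟩, ?_⟩
    · exact Finset.card_eq_three.2 ⟨_, _, _, by simp [hpq], by simp [hpr], by simp [hqr], rfl⟩
    · simp only [φ]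
      rw [Finset.sum_insert (by simp [hpq, hpr]), Finset.sum_insert (by simp [hqr]),
        Finset.sum_singleton]
      simp [pointColor, hqr', hV]
    · simp [φ, pointColor]
  · intro b h3 hs hi
    have hp : p.1 ∈ b.image pointColor := by simp [hi]
    have hq : q.1 ∈ b.image pointColor := by simp [hi]
    obtain ⟨x, hx, hcx⟩ := Finset.mem_image.1 hp
    obtain ⟨y, hy, hcy⟩ := Finset.mem_image.1 hq
    obtain ⟨w, hwx, hwy, rfl, hw⟩ := exists_third_point hV h3 hs
      (by rintro rfl; exact hpq (Subtype.ext (hcx.symm.trans hcy))) hx hy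
    rw [hcx, hcy, h] at hw
    rcases x with x | ⟨p', a⟩
    · exact (p.2 hcx.symm).elim
    rcases y with y | ⟨q', b⟩
    · exact (q.2 hcy.symm).elim
    rcases w with w | ⟨r', d⟩
    · exact (r.2 hw.symm).elim
    obtain rfl : p' = p := Subtype.ext hcx
    obtain rfl : q' = q := Subtype.ext hcy
    obtain rfl : r' = r := Subtype.ext hw
    exact ⟨(a, b, d), rfl⟩
  · constructor
    · rintro ⟨-, hS⟩
      refine ⟨fun a b => (h12 S a b).1 (hS _ _ (by simp [hpq]) ?_),
        fun a d => (h13 S a d).1 (hS _ _ (by simp [hpr]) ?_),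
        fun b d => (h23 S b d).1 (hS _ _ (by simp [hqr]) ?_)⟩
      · simp [pointColor, h]
      · simp [pointColor, hpr', Finset.pair_comm]
      · simp only [pointColor, Sum.elim_inr, hqr']
        ext
        simp
        tauto
    · rintro ⟨hS1, hS2, hS3⟩
      refine ⟨fun _ _ => trivial, fun x y hxy hi => ?_⟩
      have hx : pointColor x ∈ ({p.1, q.1, r.1} : Finset V) := by simp [← hi]
      have hy : pointColor y ∈ ({p.1, q.1, r.1} : Finset V) := by simp [← hi]
      have hne : pointColor x ≠ pointColor y := by
        intro he
        have h0 : (0 : V) ∈ ({p.1, q.1, r.1} : Finset V) := by simp [← hi, he, hV]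
        simp [p.2.symm, q.2.symm, r.2.symm] at h0
      simp only [Finset.mem_insert, Finset.mem_singleton] at hx hy
      rcases x with x | ⟨u, a⟩
      · rcases hx with hx | hx | hx
        exacts [(p.2 hx.symm).elim, (q.2 hx.symm).elim, (r.2 hx.symm).elim]
      rcases y with y | ⟨v, b⟩
      · rcases hy with hy | hy | hy
        exacts [(p.2 hy.symm).elim, (q.2 hy.symm).elim, (r.2 hy.symm).elim]
      replace hx : u = p ∨ u = q ∨ u = r := by
        simpa only [Subtype.ext_iff, pointColor, Sum.elim_inr] using hx
      replace hy : v = p ∨ v = q ∨ v = r := by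
        simpa only [Subtype.ext_iff, pointColor, Sum.elim_inr] using hy
      replace hne : u ≠ v := fun he => hne (congrArg Subtype.val he)
      rcases hx with rfl | rfl | rfl <;> rcases hy with rfl | rfl | rfl
      · exact (hne rfl).elim
      · exact (h12 S a b).2 (hS1 a b)
      · exact (h13 S a b).2 (hS2 a b)
      · exact existsUnique_mem_and_and_swap ((h12 S b a).2 (hS1 b a))
      · exact (hne rfl).elim
      · exact (h23 S a b).2 (hS3 a b)
      · exact existsUnique_mem_and_and_swap ((h13 S b a).2 (hS2 b a))
      · exact existsUnique_mem_and_and_swap ((h23 S b a).2 (hS3 b a))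
      · exact (hne rfl).elim

variable [DecidableEq G] [Fintype Z]

lemma card_partialSystem_zero :
    Nat.card {B : Finset (Finset (Z ⊕ ({p : V // p ≠ 0} × G))) // IsPartialSystem pointColor {0} B}
      = Nat.card {B : Finset (Finset Z) // isSTS B} := by
  refine Nat.card_congr ((partialSystemEquiv (fun k : Finset Z => k.card = 3)
    (fun k => k.disjSum ∅) ?_ ?_ ?_).trans (Equiv.subtypeEquivRight fun S => ?_))
  · intro k k' h
    simpa only [Finset.toLeft_disjSum] using congrArg Finset.toLeft h
  · intro k
    simp only [Finset.card_disjSum, Finset.card_empty, add_zero, Finset.sum_disjSum, pointColor]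
    refine ⟨fun h => ⟨⟨h, by simp⟩, ?_⟩, fun h => h.1.1⟩
    have hk : k.Nonempty := Finset.card_pos.1 (by omega)
    ext v
    obtain ⟨z, hz⟩ := hk
    simp only [Finset.mem_image, Finset.mem_singleton]
    constructor
    · rintro ⟨x | x, hx, rfl⟩
      · rfl
      · simp at hx
    · rintro rfl
      exact ⟨Sum.inl z, by simpa using hz, rfl⟩
  · intro b _ _ hi
    refine ⟨b.toLeft, ?_⟩
    ext (x | ⟨p, a⟩)
    · simp
    · simp only [Finset.inr_mem_disjSum, Finset.notMem_empty, false_iff]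
      intro hx
      have := Finset.mem_image_of_mem pointColor hx
      rw [hi, Finset.mem_singleton] at this
      exact p.2 this
  · refine and_congr Iff.rfl ⟨fun h x y hxy => ?_, fun h x y hxy hi => ?_⟩
    · simpa using h (Sum.inl x) (Sum.inl y) (by simpa using hxy) (by simp [pointColor])
    · have hx : pointColor x ∈ ({0} : Finset V) := by simp [← hi]
      have hy : pointColor y ∈ ({0} : Finset V) := by simp [← hi]
      rw [Finset.mem_singleton] at hx hy
      rcases x with x | x
      · rcases y with y | y
        · simpa using h x y (by simpa using hxy)
        · exact (y.1.2 hy).elim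
      · exact (x.1.2 hx).elim

variable [Fintype G]

lemma card_partialSystem_pair (hV : ∀ v : V, v + v = 0) (p : {p : V // p ≠ 0}) :
    Nat.card {B : Finset (Finset (Z ⊕ ({p : V // p ≠ 0} × G))) //
        IsPartialSystem pointColor {0, p.1} B}
      = Nat.card {f : Z → Finset (Finset G) // IsIndexedFactorization f} := by
  have hp := p.2
  let E : Finset (Z × Finset G) ≃ (Z → Finset (Finset G)) :=
    { toFun S z := Finset.univ.filter fun e => (z, e) ∈ S
      invFun f := Finset.univ.filter fun k => k.2 ∈ f k.1
      left_inv S := by ext; simp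
      right_inv f := by funext z; ext; simp }
  have hE (S z e) : e ∈ E S z ↔ (z, e) ∈ S := by simp [E]
  refine Nat.card_congr ((partialSystemEquiv (fun k : Z × Finset G => k.2.card = 2)
    (fun k => ({k.1} : Finset Z).disjSum ({p} ×ˢ k.2)) ?_ ?_ ?_).trans (E.subtypeEquiv fun S => ?_))
  · rintro ⟨z, e⟩ ⟨z', e'⟩ h
    have h1 := congrArg Finset.toLeft h
    have h2 := congrArg Finset.toRight h
    simp only [Finset.toLeft_disjSum, Finset.toRight_disjSum] at h1 h2
    refine Prod.ext (by simpa using h1) ?_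
    ext a
    have := congrArg ((p, a) ∈ ·) h2
    simpa using this
  · rintro ⟨z, e⟩
    simp only [Finset.card_disjSum, Finset.card_singleton, Finset.card_product,
      Finset.sum_disjSum, pointColor]
    refine ⟨fun h => ⟨⟨by omega, ?_⟩, ?_⟩, fun h => by omega⟩
    · simp [h, two_nsmul, hV]
    · obtain ⟨a, ha⟩ : e.Nonempty := Finset.card_pos.1 (by omega)
      ext v
      simp only [Finset.mem_image, Finset.mem_insert, Finset.mem_singleton]
      constructor
      · rintro ⟨x | ⟨q, x⟩, hx, rfl⟩
        · exact Or.inl rfl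
        · simp only [Finset.inr_mem_disjSum, Finset.mem_product, Finset.mem_singleton] at hx
          exact Or.inr (by simp [hx.1])
      · rintro (rfl | rfl)
        · exact ⟨Sum.inl z, by simp, rfl⟩
        · exact ⟨Sum.inr (p, a), by simpa using ha, rfl⟩
  · intro b h3 hs hi
    have h0 : (0 : V) ∈ b.image pointColor := by simp [hi]
    have h1 : p.1 ∈ b.image pointColor := by simp [hi]
    obtain ⟨x, hx, hcx⟩ := Finset.mem_image.1 h0
    obtain ⟨y, hy, hcy⟩ := Finset.mem_image.1 h1
    obtain ⟨w, hwx, hwy, rfl, hw⟩ := exists_third_point hV h3 hs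
      (by rintro rfl; exact hp (hcy.symm.trans hcx)) hx hy
    rw [hcx, hcy, zero_add] at hw
    rcases x with z | ⟨q, a⟩
    swap
    · exact (q.2 hcx).elim
    rcases y with z' | ⟨q, a⟩
    · exact (hp hcy.symm).elim
    rcases w with z' | ⟨q', a'⟩
    · exact (hp hw.symm).elim
    obtain rfl : q = p := Subtype.ext hcy
    obtain rfl : q' = q := Subtype.ext hw
    refine ⟨(z, {a, a'}), ?_⟩
    ext (x | ⟨q, x⟩)
    · simp
    · simp
  · have hmem (z : Z) (a : G) :
        (∃! k, k ∈ S ∧ Sum.inl z ∈ ({k.1} : Finset Z).disjSum ({p} ×ˢ k.2) ∧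
        Sum.inr (p, a) ∈ ({k.1} : Finset Z).disjSum ({p} ×ˢ k.2)) ↔ ∃! e, e ∈ E S z ∧ a ∈ e := by
      simp only [hE, Finset.inl_mem_disjSum, Finset.inr_mem_disjSum, Finset.mem_singleton,
        Finset.mem_product, true_and]
      constructor
      · rintro ⟨⟨z', e⟩, ⟨hk, rfl, ha⟩, hu⟩
        exact ⟨e, ⟨hk, ha⟩, fun e' he' => congrArg Prod.snd (hu (z, e') ⟨he'.1, rfl, he'.2⟩)⟩
      · rintro ⟨e, ⟨he, ha⟩, hu⟩
        refine ⟨(z, e), ⟨he, rfl, ha⟩, ?_⟩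
        rintro ⟨z', e'⟩ ⟨hk, rfl, ha'⟩
        rw [hu e' ⟨hk, ha'⟩]
    have hmem' (hc : ∀ k ∈ S, k.2.card = 2) {a a' : G} (haa : a ≠ a') :
        (∃! k, k ∈ S ∧ Sum.inr (p, a) ∈ ({k.1} : Finset Z).disjSum ({p} ×ˢ k.2) ∧
        Sum.inr (p, a') ∈ ({k.1} : Finset Z).disjSum ({p} ×ˢ k.2)) ↔ ∃! z, {a, a'} ∈ E S z := by
      simp only [hE, Finset.inr_mem_disjSum, Finset.mem_singleton, Finset.mem_product, true_and]
      have key (k) (hk : k ∈ S) (ha : a ∈ k.2) (ha' : a' ∈ k.2) : k.2 = {a, a'} := by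
        refine (Finset.eq_of_subset_of_card_le ?_ ?_).symm
        · simp [Finset.insert_subset_iff, ha, ha']
        · rw [hc k hk, Finset.card_pair haa]
      constructor
      · rintro ⟨⟨z, e⟩, ⟨hk, ha, ha'⟩, hu⟩
        obtain rfl := key _ hk ha ha'
        exact ⟨z, hk, fun z' hz' => congrArg Prod.fst (hu (z', _) ⟨hz', ha, ha'⟩)⟩
      · rintro ⟨z, hz, hu⟩
        refine ⟨(z, {a, a'}), ⟨hz, by simp, by simp⟩, ?_⟩
        rintro ⟨z', e'⟩ ⟨hk, ha, ha'⟩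
        obtain rfl := key _ hk ha ha'
        rw [hu z' hk]
    constructor
    · rintro ⟨hc, h⟩
      refine ⟨fun z => ⟨fun e he => hc (z, e) ((hE _ _ _).1 he), fun a => ?_⟩, fun e he => ?_⟩
      · exact (hmem z a).1 (h _ _ (by simp) (by simp [pointColor]))
      · obtain ⟨a, a', haa, rfl⟩ := Finset.card_eq_two.1 he
        refine (hmem' hc haa).1 (h _ _ (by simpa using haa) ?_)
        simp [pointColor, hV, Finset.pair_comm]
    · rintro ⟨hf, h⟩
      have hc : ∀ k ∈ S, k.2.card = 2 := fun k hk => (hf k.1).1 _ ((hE _ _ _).2 hk)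
      refine ⟨hc, fun x y hxy hi => ?_⟩
      have hx : pointColor x ∈ ({0, p.1} : Finset V) := by simp [← hi]
      have hy : pointColor y ∈ ({0, p.1} : Finset V) := by simp [← hi]
      rw [Finset.mem_insert, Finset.mem_singleton] at hx hy
      rcases x with z | ⟨q, a⟩ <;> rcases y with z' | ⟨q', a'⟩
      · have := congrArg (p.1 ∈ ·) hi
        simp [pointColor, hp] at this
      · obtain rfl : q' = p := Subtype.ext (hy.resolve_left q'.2)
        exact (hmem z a').2 ((hf z).2 a')
      · obtain rfl : q = p := Subtype.ext (hx.resolve_left q.2)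
        exact existsUnique_mem_and_and_swap ((hmem z' a).2 ((hf z').2 a))
      · obtain rfl : q = p := Subtype.ext (hx.resolve_left q.2)
        obtain rfl : q' = q := Subtype.ext (hy.resolve_left q'.2)
        have haa : a ≠ a' := by rintro rfl; exact hxy rfl
        exact (hmem' hc haa).2 (h _ (Finset.card_pair haa))

end Counting

lemma isOneFactor.nonempty {G : Type*} {f : Finset (Finset G)} [Nonempty G] (hf : isOneFactor f) :
    f.Nonempty := by
  obtain ⟨e, he, -⟩ := hf.2 (Classical.arbitrary G)
  exact ⟨e, he.1⟩

lemma isOneFactorization.card_eq {g : ℕ} [NeZero g] {F : Finset (Finset (Finset (Fin g)))}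
    (hF : isOneFactorization F) : F.card = g - 1 := by
  have hc : ((Finset.univ : Finset (Fin g)).erase 0).card = g - 1 := by
    simp [Finset.card_erase_of_mem]
  rw [← hc]
  symm
  have hfac (y : Fin g) (hy : y ∈ Finset.univ.erase 0) : ∃ f ∈ F, ({0, y} : Finset (Fin g)) ∈ f :=
    (hF.2 {0, y} (Finset.card_pair (by simpa using Ne.symm (Finset.ne_of_mem_erase hy)))).exists
  choose φ hφ hφe using hfac
  refine Finset.card_bij φ hφ (fun y hy y' hy' h => ?_) (fun f hf => ?_)
  · have he := ((hF.1 _ (hφ y hy)).2 0).unique ⟨hφe y hy, by simp⟩ ⟨h ▸ hφe y' hy', by simp⟩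
    have : y ∈ ({0, y'} : Finset (Fin g)) := he ▸ by simp
    simpa [Finset.ne_of_mem_erase hy] using this
  · obtain ⟨e, he, h0⟩ := ((hF.1 f hf).2 0).exists
    have h2 := (hF.1 f hf).1 e he
    obtain ⟨y, hy⟩ := Finset.card_eq_one.1 (show (e.erase 0).card = 1 by
      rw [Finset.card_erase_of_mem h0, h2])
    have hy0 : y ∈ Finset.univ.erase 0 := by
      have : y ∈ e.erase 0 := by simp [hy]
      simpa using Finset.ne_of_mem_erase this
    obtain rfl : e = {0, y} := by rw [← Finset.insert_erase h0, hy]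
    exact ⟨y, hy0, (hF.2 _ h2).unique ⟨hφ y hy0, hφe y hy0⟩ ⟨hf, he⟩⟩

lemma card_indexedFactorization {g : ℕ} [NeZero g] :
    Nat.card {f : Fin (g - 1) → Finset (Finset (Fin g)) // IsIndexedFactorization f}
      = N2 g * (g - 1).factorial := by
  classical
  let X := Σ F : {F : Finset (Finset (Finset (Fin g))) // isOneFactorization F}, Fin (g - 1) ≃ F.1
  have hX : Nat.card X = N2 g * (g - 1).factorial := by
    have hc (F : {F : Finset (Finset (Finset (Fin g))) // isOneFactorization F}) :
        Nat.card (Fin (g - 1) ≃ F.1) = (g - 1).factorial := by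
      rw [Nat.card_eq_fintype_card,
        Fintype.card_equiv (Fintype.equivOfCardEq (by simp [F.2.card_eq])), Fintype.card_fin]
    rw [Nat.card_sigma, Finset.sum_congr rfl fun F _ => hc F, Finset.sum_const, smul_eq_mul,
      Finset.card_univ, ← Nat.card_eq_fintype_card, N2]
  rw [← hX]
  symm
  refine Nat.card_eq_of_bijective (fun x : X => ⟨fun z => (x.2 z).1, ?_, ?_⟩) ⟨?_, ?_⟩
  · exact fun z => x.1.2.1 _ (x.2 z).2
  · intro e he
    obtain ⟨f, ⟨hf, hef⟩, hu⟩ := x.1.2.2 e he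
    refine ⟨x.2.symm ⟨f, hf⟩, by simpa using hef, fun z hz => ?_⟩
    rw [Equiv.eq_symm_apply]
    exact Subtype.ext (hu _ ⟨(x.2 z).2, hz⟩)
  · rintro ⟨⟨F, hF⟩, e⟩ ⟨⟨F', hF'⟩, e'⟩ h
    have h' (z) : (e z).1 = (e' z).1 := congrFun (congrArg Subtype.val h) z
    obtain rfl : F = F' := by
      ext f
      constructor
      · intro hf
        have := h' (e.symm ⟨f, hf⟩)
        rw [Equiv.apply_symm_apply] at this
        change f = _ at this
        rw [this]
        exact (e' _).2
      · intro hf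
        have := h' (e'.symm ⟨f, hf⟩)
        rw [Equiv.apply_symm_apply] at this
        change _ = f at this
        rw [← this]
        exact (e _).2
    obtain rfl : e = e' := Equiv.ext fun z => Subtype.ext (h' z)
    rfl
  · rintro ⟨f, h1, h2⟩
    have hinj : Function.Injective f := by
      intro z z' hz
      obtain ⟨e, he⟩ := (h1 z).nonempty
      exact (h2 e ((h1 z).1 e he)).unique he (hz ▸ he)
    refine ⟨⟨⟨Finset.univ.image f, ?_, ?_⟩, Equiv.ofBijective
      (fun z => ⟨f z, Finset.mem_image_of_mem f (Finset.mem_univ z)⟩) ⟨?_, ?_⟩⟩, rfl⟩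
    · simpa using h1
    · intro e he
      obtain ⟨z, hz, hu⟩ := h2 e he
      refine ⟨f z, ⟨by simp, hz⟩, ?_⟩
      rintro f' ⟨hf', hef⟩
      obtain ⟨z', -, rfl⟩ := Finset.mem_image.1 hf'
      rw [hu z' hef]
    · exact fun z z' hz => hinj (congrArg Subtype.val hz)
    · rintro ⟨f', hf'⟩
      obtain ⟨z', -, rfl⟩ := Finset.mem_image.1 hf'
      exact ⟨z', rfl⟩

section Lines

variable {V : Type*} [AddCommGroup V]

lemma add_ne_zero_of_ne (hV : ∀ v : V, v + v = 0) {p q : V} (hpq : p ≠ q) : p + q ≠ 0 := by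
  intro h
  have hq := eq_add_of_add_eq_zero hV (u := p) (v := 0) (w := q) (by simpa using h)
  exact hpq (by rw [hq, add_zero])

variable [DecidableEq V]

/-- The set `i` consists of the three nonzero elements of a subgroup of order four. -/
def IsLine (i : Finset V) : Prop :=
  ∃ p q : V, p ≠ 0 ∧ q ≠ 0 ∧ p ≠ q ∧ i = {p, q, p + q}

lemma IsLine.card_eq {i : Finset V} (hi : IsLine i) : i.card = 3 := by
  obtain ⟨p, q, hp, hq, hpq, rfl⟩ := hi
  exact Finset.card_eq_three.2 ⟨p, q, p + q, hpq,
    by simpa using hq, by simpa using hp, rfl⟩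

lemma IsLine.eq_of_mem (hV : ∀ v : V, v + v = 0) {i : Finset V} (hi : IsLine i) {u v : V}
    (hu : u ∈ i) (hv : v ∈ i) (huv : u ≠ v) : ({u, v, u + v} : Finset V) = i := by
  obtain ⟨p, q, hp, hq, hpq, rfl⟩ := hi
  have h1 : p + (p + q) = q := by rw [← add_assoc, hV, zero_add]
  have h2 : q + (p + q) = p := by rw [add_left_comm, hV, add_zero]
  have h3 : p + q + p = q := by rw [add_comm, h1]
  have h4 : p + q + q = p := by rw [add_comm, h2]
  have h5 : q + p = p + q := add_comm q p
  simp only [Finset.mem_insert, Finset.mem_singleton] at hu hv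
  rcases hu with rfl | rfl | rfl <;> rcases hv with rfl | rfl | rfl <;>
    first
    | exact (huv rfl).elim
    | rfl
    | (ext; simp only [h1, h2, h3, h4, h5, Finset.mem_insert, Finset.mem_singleton]; tauto)

lemma card_lines [Fintype V] [DecidablePred (IsLine (V := V))] (hV : ∀ v : V, v + v = 0) :
    (Finset.univ.filter (IsLine (V := V))).card * 6
      = (Fintype.card V - 1) * (Fintype.card V - 2) := by
  have hc : ((Finset.univ : Finset V).erase 0).offDiag.card
      = (Fintype.card V - 1) * (Fintype.card V - 2) := by
    rw [Finset.offDiag_card, Finset.card_erase_of_mem (Finset.mem_univ _), Finset.card_univ,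
      ← Nat.mul_sub_one, Nat.sub_sub]
  rw [← hc, Finset.card_eq_sum_card_fiberwise
    (f := fun k : V × V => ({k.1, k.2, k.1 + k.2} : Finset V))
    (t := Finset.univ.filter IsLine), Finset.sum_const_nat]
  · intro i hi
    rw [Finset.mem_filter] at hi
    have h0 : (0 : V) ∉ i := by
      obtain ⟨p, q, hp, hq, hpq, rfl⟩ := hi.2
      simp [hp.symm, hq.symm, (add_ne_zero_of_ne hV hpq).symm]
    rw [show 6 = i.offDiag.card by rw [Finset.offDiag_card, hi.2.card_eq]]
    congr 1
    ext ⟨u, v⟩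
    simp only [Finset.mem_filter, Finset.mem_offDiag, Finset.mem_erase, Finset.mem_univ, and_true]
    constructor
    · rintro ⟨⟨-, -, huv⟩, rfl⟩
      exact ⟨by simp, by simp, huv⟩
    · rintro ⟨hu, hv, huv⟩
      exact ⟨⟨ne_of_mem_of_not_mem hu h0, ne_of_mem_of_not_mem hv h0, huv⟩,
        hi.2.eq_of_mem hV hu hv huv⟩
  · rintro ⟨u, v⟩ h
    simp only [Finset.mem_coe, Finset.mem_offDiag, Finset.mem_erase, Finset.mem_univ,
      and_true] at h
    simpa using ⟨u, v, h.1, h.2.1, h.2.2, rfl⟩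

lemma eq_singleton_or_pair_or_isLine (hV : ∀ v : V, v + v = 0) (u v : V) :
    ({u, v, u + v} : Finset V) = {0} ∨
      (∃ p : {p : V // p ≠ 0}, {0, p.1} = ({u, v, u + v} : Finset V)) ∨
        IsLine ({u, v, u + v} : Finset V) := by
  by_cases hu : u = 0
  · by_cases hv : v = 0
    · exact Or.inl (by simp [hu, hv])
    · exact Or.inr (Or.inl ⟨⟨v, hv⟩, by simp [hu]⟩)
  · by_cases hv : v = 0
    · exact Or.inr (Or.inl ⟨⟨u, hu⟩, by simp [hv]⟩)
    · by_cases huv : u = v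
      · exact Or.inr (Or.inl ⟨⟨u, hu⟩, by simp [← huv, hV, Finset.pair_comm]⟩)
      · exact Or.inr (Or.inr ⟨u, v, hu, hv, huv, rfl⟩)

lemma card_partialSystem_eq_one {α : Type*} [DecidableEq α] (hV : ∀ v : V, v + v = 0) (c : α → V)
    {i : Finset V} (hi : ∀ u v : V, ({u, v, u + v} : Finset V) ≠ i) :
    Nat.card {B : Finset (Finset α) // IsPartialSystem c i B} = 1 := by
  rw [Nat.card_eq_one_iff_exists]
  refine ⟨⟨∅, by simp, fun x y _ h => (hi _ _ h).elim⟩, fun B => Subtype.ext ?_⟩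
  refine Finset.eq_empty_of_forall_notMem fun b hb => ?_
  obtain ⟨⟨h3, hs⟩, h⟩ := B.2.1 b hb
  obtain ⟨x, hx, y, hy, hxy⟩ := Finset.one_lt_card.1 (show 1 < b.card by omega)
  exact hi _ _ ((image_eq_of_mem hV h3 hs hxy hx hy).symm.trans h)

lemma card_zeroSum_sts [Fintype V] (hV : ∀ v : V, v + v = 0) (g : ℕ) [NeZero g] :
    Nat.card {B : Finset (Finset (Fin (g - 1) ⊕ ({p : V // p ≠ 0} × Fin g))) //
        isSTS B ∧ ∀ b ∈ B, ∑ j ∈ b, pointColor j = 0} =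
      N1 (g - 1) * (N2 g * (g - 1).factorial) ^ (Fintype.card V - 1) *
        N3 g ^ ((Fintype.card V - 1) * (Fintype.card V - 2) / 6) := by
  classical
  rw [Nat.card_congr (systemEquivPi hV pointColor), Nat.card_pi]
  set f : Finset V → ℕ := fun i => Nat.card
    {B : Finset (Finset (Fin (g - 1) ⊕ ({p : V // p ≠ 0} × Fin g))) //
      IsPartialSystem pointColor i B}
  let pairs : Finset (Finset V) := Finset.univ.image fun p : {p : V // p ≠ 0} => {0, p.1}
  let lines : Finset (Finset V) := Finset.univ.filter IsLine
  have hpairs : ∀ i ∈ pairs, i.card = 2 := by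
    intro i hi
    obtain ⟨p, -, rfl⟩ := Finset.mem_image.1 hi
    exact Finset.card_pair p.2.symm
  have hlines : ∀ i ∈ lines, i.card = 3 := fun i hi => (Finset.mem_filter.1 hi).2.card_eq
  have hd1 : Disjoint ({{0}} : Finset (Finset V)) pairs := by
    rw [Finset.disjoint_singleton_left]
    intro h
    simpa using hpairs _ h
  have hd2 : Disjoint ({{0}} ∪ pairs) lines := by
    rw [Finset.disjoint_left]
    intro i hi hl
    have h3 := hlines i hl
    rcases Finset.mem_union.1 hi with h | h
    · rw [Finset.mem_singleton.1 h] at h3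
      simp at h3
    · rw [hpairs i h] at h3
      omega
  have hinj : Function.Injective fun p : {p : V // p ≠ 0} => ({0, p.1} : Finset V) := by
    intro p q h
    have : p.1 ∈ ({0, q.1} : Finset V) := (show ({0, p.1} : Finset V) = {0, q.1} from h) ▸ by simp
    exact Subtype.ext (by simpa [p.2] using this)
  have hsub : ∏ i, f i = ∏ i ∈ ({{0}} ∪ pairs) ∪ lines, f i := by
    refine (Finset.prod_subset (Finset.subset_univ _) fun i _ hi => ?_).symm
    refine card_partialSystem_eq_one hV _ ?_
    rintro u v rfl
    refine hi ?_
    simpa [pairs, lines, or_assoc] using eq_singleton_or_pair_or_isLine hV u v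
  have hf2 (i) (hi : i ∈ lines) : f i = N3 g := by
    obtain ⟨p, q, hp, hq, hpq, rfl⟩ := (Finset.mem_filter.1 hi).2
    exact card_partialSystem_line hV (p := ⟨p, hp⟩) (q := ⟨q, hq⟩)
      (r := ⟨p + q, add_ne_zero_of_ne hV hpq⟩) (by simpa using hpq) (by simpa using hq)
      (by simpa using hp) rfl
  have hf1 (p : {p : V // p ≠ 0}) : f {0, p.1} = N2 g * (g - 1).factorial :=
    (card_partialSystem_pair hV p).trans card_indexedFactorization
  have hf0 : f {0} = N1 (g - 1) := card_partialSystem_zero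
  rw [hsub, Finset.prod_union hd2, Finset.prod_union hd1, Finset.prod_singleton,
    Finset.prod_image hinj.injOn, Finset.prod_congr rfl fun p _ => hf1 p,
    Finset.prod_congr rfl hf2, Finset.prod_const, Finset.prod_const, hf0, ← card_lines hV,
    Nat.mul_div_cancel _ (by norm_num), Finset.card_univ, Fintype.card_subtype_compl,
    Fintype.card_subtype_eq]

end Lines

theorem stmt7 (n t : ℕ) (ht1 : 1 ≤ t) (ht2 : t ≤ n - 1) :
    Nat.card {B : Finset (Finset (binIdx n t)) //
        isSTS B ∧ ∀ b ∈ B, ∑ j ∈ b, binCol j = 0} =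
      N1 (2 ^ t - 1) * (N2 (2 ^ t) * Nat.factorial (2 ^ t - 1)) ^ (2 ^ (n - t) - 1) *
        N3 (2 ^ t) ^ ((2 ^ (n - t) - 1) * (2 ^ (n - t) - 2) / 6) := by
  have hV (v : Fin (n - t) → ZMod 2) : v + v = 0 := funext fun j => CharTwo.add_self_eq_zero (v j)
  have h := card_zeroSum_sts hV (2 ^ t)
  rw [Fintype.card_fun, ZMod.card, Fintype.card_fin] at h
  exact h
end
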